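/- For each n ≥ 1, let X_n and Y_n denote, respectively, the number of occurrences of (2,3,4) and of (4,3,2) in a composition of n chosen uniformly at random from the 2^(n−1) compositions of n, and let ρ_n = Cov(X_n, Y_n) / (√Var(X_n) · √Var(Y_n)) be their correlation coefficient (defined for n large enough that both variances are positive). Then lim_{n→∞} ρ_n = 71/147. -/

import Mathlib

/-- `Occurs b c i` says that the composition (list) `b = (b_1, …, b_s)` occurs in
`c = (c_1, …, c_k)` at (0-indexed) position `i`: `i + s ≤ k` and `b_j ≤ c_{i+j}`
for all `0 ≤ j < s`. -/
def Occurs (b c : List ℕ) (i : ℕ) : Prop :=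
  i + b.length ≤ c.length ∧ ∀ j < b.length, b.getD j 0 ≤ c.getD (i + j) 0

instance (b c : List ℕ) (i : ℕ) : Decidable (Occurs b c i) :=
  inferInstanceAs
    (Decidable (i + b.length ≤ c.length ∧ ∀ j < b.length, b.getD j 0 ≤ c.getD (i + j) 0))

/-- The composition `c` includes (contains) the composition `b`. -/
def Contains (c b : List ℕ) : Prop := ∃ i, Occurs b c i

/-- The number of occurrences of `b` in `c` (number of positions at which `b` occurs). -/
def numOcc (b c : List ℕ) : ℕ :=
  ((Finset.range (c.length + 1)).filter fun i => Occurs b c i).card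

/-- Expectation, over the uniform distribution on compositions of `n`, of a
real-valued statistic. -/
noncomputable def compExp (n : ℕ) (f : Composition n → ℝ) : ℝ :=
  (∑ C : Composition n, f C) / 2 ^ (n - 1)

/-- The number of occurrences of `(2,3,4)` in a composition, as a random variable. -/
def occX (n : ℕ) (C : Composition n) : ℝ := numOcc [2, 3, 4] C.blocks

/-- The number of occurrences of `(4,3,2)` in a composition, as a random variable. -/
def occY (n : ℕ) (C : Composition n) : ℝ := numOcc [4, 3, 2] C.blocks

/-- The variance of a statistic over the uniform distribution on compositions of `n`. -/
noncomputable def compVar (n : ℕ) (f : Composition n → ℝ) : ℝ :=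
  compExp n (fun C => f C ^ 2) - (compExp n f) ^ 2

/-- The covariance of two statistics over the uniform distribution on compositions
of `n`. -/
noncomputable def compCov (n : ℕ) (f g : Composition n → ℝ) : ℝ :=
  compExp n (fun C => f C * g C) - compExp n f * compExp n g

/-- The correlation coefficient of the numbers of occurrences of `(2,3,4)` and of
`(4,3,2)` in a uniformly random composition of `n`. -/
noncomputable def rho (n : ℕ) : ℝ :=
  compCov n (occX n) (occY n) /
    (Real.sqrt (compVar n (occX n)) * Real.sqrt (compVar n (occY n)))

open PowerSeries Filter Topology

/-- sum of a list statistic over compositions of `n` -/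
noncomputable def TT (f : List ℕ → ℝ) (n : ℕ) : ℝ := ∑ C : Composition n, f C.blocks

noncomputable def GG (f : List ℕ → ℝ) : PowerSeries ℝ := PowerSeries.mk (TT f)

def UU (k : ℕ) (h : List ℕ → ℝ) : List ℕ → ℝ
  | [] => 0
  | a :: c => if k ≤ a then h c else 0

def nilInd : List ℕ → ℝ
  | [] => 1
  | _ :: _ => 0

theorem GG_add (f g : List ℕ → ℝ) : GG (f + g) = GG f + GG g := by
  ext n; simp [GG, TT, Finset.sum_add_distrib]

theorem GG_nil : GG nilInd = 1 := by
  ext n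
  simp only [GG, TT, coeff_mk, coeff_one]
  rcases Nat.eq_zero_or_pos n with rfl | hn
  · have : ∀ C : Composition 0, nilInd C.blocks = 1 := by
      intro C
      have : C.blocks = [] := by
        rcases h : C.blocks with _ | ⟨a, l⟩
        · rfl
        · have h1 := C.blocks_sum
          have h2 : 0 < a := C.blocks_pos (by rw [h]; simp)
          rw [h] at h1; simp at h1; omega
      rw [this]; rfl
    simp [this, composition_card]
  · rw [if_neg (by omega)]
    apply Finset.sum_eq_zero
    intro C _
    rcases h : C.blocks with _ | ⟨a, l⟩
    · have h1 := C.blocks_sum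
      rw [h] at h1; simp at h1; omega
    · rfl

noncomputable def SS (k : ℕ) : PowerSeries ℝ := PowerSeries.mk fun i => if k ≤ i then 1 else 0

noncomputable def consC {n : ℕ} (p : ℕ × ℕ) (hp : p.1 + p.2 = n) (h1 : 1 ≤ p.1)
    (C : Composition p.2) : Composition n where
  blocks := p.1 :: C.blocks
  blocks_pos := by
    intro i hi
    rcases List.mem_cons.1 hi with rfl | hi
    · exact h1
    · exact C.blocks_pos hi
  blocks_sum := by simp [C.blocks_sum, hp]

theorem GG_U (k : ℕ) (hk : 1 ≤ k) (h : List ℕ → ℝ) : GG (UU k h) = SS k * GG h := by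
  ext n
  simp only [GG, TT, SS, coeff_mk, coeff_mul, Finset.mul_sum]
  rw [Finset.sum_sigma']
  symm
  apply Finset.sum_bij_ne_zero
    (i := fun (x : (p : ℕ × ℕ) × Composition p.2) hx hx0 =>
      consC x.1 (by simpa using hx) (by
        by_contra hc
        apply hx0
        rw [if_neg (by omega)]; simp) x.2)
  · intros; simp
  · rintro ⟨⟨a, b⟩, C⟩ hx hx0 ⟨⟨a', b'⟩, C'⟩ hx' hx0' heq
    have hb := congrArg Composition.blocks heq
    simp only [consC, List.cons.injEq] at hb
    obtain ⟨rfl, hb⟩ := hb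
    have : b = b' := by
      have h1 := C.blocks_sum
      have h2 := C'.blocks_sum
      rw [hb, h2] at h1
      exact h1.symm
    subst this
    have : C = C' := Composition.ext hb
    rw [this]
  · intro C _ hC
    rcases hl : C.blocks with _ | ⟨a, l⟩
    · rw [hl] at hC; simp [UU] at hC
    · have hs := C.blocks_sum
      rw [hl] at hs hC
      simp only [List.sum_cons] at hs
      refine ⟨⟨(a, l.sum), ⟨l, ?_, rfl⟩⟩, ?_, ?_, ?_⟩
      · intro i hi; exact C.blocks_pos (by rw [hl]; simp [hi])
      · simpa using hs
      · simp only [UU] at hC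
        split_ifs at hC with h1
        · simpa [h1] using hC
        · simp at hC
      · apply Composition.ext
        simp [consC, hl]
  · rintro ⟨⟨a, b⟩, C⟩ hx hx0
    simp only [consC, UU]
    split_ifs <;> simp

noncomputable def AA : PowerSeries ℝ := PowerSeries.mk fun n => 2 ^ n
noncomputable def BB : PowerSeries ℝ := PowerSeries.mk fun _ => 1

theorem AA_eq : AA * (1 - 2 * X) = 1 := by
  have : (2 : PowerSeries ℝ) = C (2:ℝ) := (map_ofNat C 2).symm
  rw [this]
  ext n
  rcases n with _ | n
  · simp [AA, mul_sub]
  · rw [mul_sub, mul_one, mul_left_comm, map_sub, coeff_C_mul, coeff_succ_mul_X]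
    simp [AA, coeff_one, pow_succ]; ring

theorem BB_eq : BB * (1 - X) = 1 := by
  ext n
  rcases n with _ | n
  · simp [BB, mul_sub]
  · rw [mul_sub, mul_one, map_sub, coeff_succ_mul_X]
    simp [BB, coeff_one]

theorem SS_eq (k : ℕ) : SS k = X ^ k * BB := by
  ext n
  rw [coeff_X_pow_mul']
  simp [SS, BB]

theorem AB : AA * BB = 2 * AA - BB := by
  linear_combination 2 * AA * BB_eq - BB * AA_eq

/-- asymptotics -/
def Asy (F : PowerSeries ℝ) (a b c : ℝ) : Prop :=
  Tendsto (fun n : ℕ => (n : ℝ) * (coeff n F / 2 ^ n - (a * n ^ 2 + b * n + c))) atTop (𝓝 0)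

theorem Asy.add {F G a b c a' b' c'} (h : Asy F a b c) (h' : Asy G a' b' c') :
    Asy (F + G) (a + a') (b + b') (c + c') := by
  unfold Asy at *
  have := Tendsto.add h h'
  simp only [add_zero] at this
  refine this.congr fun n => ?_
  rw [map_add]; ring

theorem Asy.smul {F a b c} (r : ℝ) (h : Asy F a b c) :
    Asy (C r * F) (r * a) (r * b) (r * c) := by
  unfold Asy at *
  have := Tendsto.const_mul r h
  simp only [mul_zero] at this
  refine this.congr fun n => ?_
  rw [coeff_C_mul]; ring

theorem Asy.shift1 {F a b c} (h : Asy F a b c) :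
    Asy (X * F) (a / 2) ((b - 2 * a) / 2) ((a - b + c) / 2) := by
  unfold Asy at *
  rw [← tendsto_add_atTop_iff_nat 1]
  have h2 : Tendsto (fun n : ℕ => (1 + 1 / (n : ℝ)) / 2) atTop (𝓝 ((1 + 0) / 2)) :=
    (tendsto_const_nhds.add tendsto_one_div_atTop_nhds_zero_nat).div_const 2
  have := h.mul h2
  simp only [zero_mul] at this
  refine this.congr' ?_
  filter_upwards [eventually_gt_atTop 0] with n hn
  rw [mul_comm X F, coeff_succ_mul_X]
  have : (n : ℝ) ≠ 0 := by positivity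
  push_cast
  field_simp
  ring

theorem Asy.congr {F a b c a' b' c'} (h : Asy F a b c) (ha : a = a') (hb : b = b') (hc : c = c') :
    Asy F a' b' c' := by subst ha hb hc; exact h

theorem Asy.shift {F a b c} (k : ℕ) (h : Asy F a b c) :
    Asy (X ^ k * F) (a / 2 ^ k) ((b - 2 * a * k) / 2 ^ k) ((a * k ^ 2 - b * k + c) / 2 ^ k) := by
  induction k with
  | zero => simpa using h
  | succ k ih =>
    rw [pow_succ', mul_assoc]
    refine ih.shift1.congr ?_ ?_ ?_
    · rw [pow_succ]; field_simp
    · rw [pow_succ]; push_cast; field_simp; ring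
    · rw [pow_succ]; push_cast; field_simp; ring

theorem asyA : Asy AA 0 0 1 := by
  unfold Asy; simp [AA]

theorem coeff_sq (r : ℝ) (n : ℕ) :
    coeff n ((PowerSeries.mk fun n => r ^ n) ^ 2) = (n + 1) * r ^ n := by
  rw [sq, coeff_mul]
  rw [Finset.sum_congr rfl (g := fun _ => r ^ n)]
  · simp
  · rintro ⟨i, j⟩ h
    simp at h
    simp [← h, pow_add]

theorem coeff_cube (r : ℝ) (n : ℕ) :
    coeff n ((PowerSeries.mk fun n => r ^ n) ^ 3) = (n + 1) * (n + 2) / 2 * r ^ n := by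
  rw [pow_succ, coeff_mul]
  rw [Finset.sum_congr rfl (g := fun p : ℕ × ℕ => (p.1 + 1 : ℝ) * r ^ n)]
  · rw [← Finset.sum_mul, Finset.Nat.sum_antidiagonal_eq_sum_range_succ_mk]
    congr 1
    induction n with
    | zero => simp
    | succ n ih =>
      rw [Finset.sum_range_succ, ih]; push_cast; ring
  · rintro ⟨i, j⟩ h
    simp at h
    rw [coeff_sq]
    simp [← h, pow_add, mul_assoc]

theorem asyA2 : Asy (AA ^ 2) 0 1 1 := by
  unfold Asy
  refine tendsto_const_nhds.congr fun n => ?_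
  rw [AA, coeff_sq]; field_simp; ring

theorem asyA3 : Asy (AA ^ 3) (1/2) (3/2) 1 := by
  unfold Asy
  refine tendsto_const_nhds.congr fun n => ?_
  rw [AA, coeff_cube]; field_simp; ring

theorem BB_eq' : BB = PowerSeries.mk fun n => (1:ℝ) ^ n := by simp [BB]

theorem powlim (k : ℕ) : Tendsto (fun n : ℕ => (n : ℝ) ^ k / 2 ^ n) atTop (𝓝 0) :=
  tendsto_pow_const_div_const_pow_of_one_lt k (by norm_num)

theorem asyB : Asy BB 0 0 0 := by
  unfold Asy
  refine (powlim 1).congr fun n => ?_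
  simp [BB]; ring

theorem asyB2 : Asy (BB ^ 2) 0 0 0 := by
  unfold Asy
  have := (powlim 2).add (powlim 1)
  rw [add_zero] at this
  refine this.congr fun n => ?_
  rw [BB_eq', coeff_sq]; field_simp; simp

theorem asyB3 : Asy (BB ^ 3) 0 0 0 := by
  unfold Asy
  have := (((powlim 3).add ((powlim 2).const_mul 3)).add ((powlim 1).const_mul 2)).div_const 2
  simp only [mul_zero, add_zero, zero_div] at this
  refine this.congr fun n => ?_
  rw [BB_eq', coeff_cube]; field_simp; simp; left; ring



theorem asyA2B : Asy (AA ^ 2 * BB) 0 2 0 := by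
  have e : AA ^ 2 * BB = C (2:ℝ) * AA ^ 2 + (C (-2:ℝ) * AA + BB) := by
    simp only [map_neg, map_ofNat]
    linear_combination (AA - 1) * AB
  rw [e]
  exact ((asyA2.smul 2).add ((asyA.smul (-2)).add asyB)).congr
    (by norm_num) (by norm_num) (by norm_num)

theorem asyA2B2 : Asy (AA ^ 2 * BB ^ 2) 0 4 (-4) := by
  have e : AA ^ 2 * BB ^ 2 = C (4:ℝ) * AA ^ 2 + (C (-8:ℝ) * AA + (C (4:ℝ) * BB + BB ^ 2)) := by
    simp only [map_neg, map_ofNat]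
    linear_combination (AA * BB + 2 * AA - BB - 4) * AB
  rw [e]
  exact ((asyA2.smul 4).add ((asyA.smul (-8)).add ((asyB.smul 4).add asyB2))).congr
    (by norm_num) (by norm_num) (by norm_num)

theorem asyA2B3 : Asy (AA ^ 2 * BB ^ 3) 0 8 (-16) := by
  have e : AA ^ 2 * BB ^ 3 = C (8:ℝ) * AA ^ 2 + (C (-24:ℝ) * AA + (C (12:ℝ) * BB
      + (C (4:ℝ) * BB ^ 2 + BB ^ 3))) := by
    simp only [map_neg, map_ofNat]
    linear_combination (BB * (AA * BB + 2 * AA - BB - 4) + 4 * (AA - 1) - 8) * AB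
  rw [e]
  exact ((asyA2.smul 8).add ((asyA.smul (-24)).add ((asyB.smul 12).add
    ((asyB2.smul 4).add asyB3)))).congr
    (by norm_num) (by norm_num) (by norm_num)

theorem asyA3B3 : Asy (AA ^ 3 * BB ^ 3) 4 (-12) 32 := by
  have e : AA ^ 3 * BB ^ 3 = C (8:ℝ) * AA ^ 3 + (C (-24:ℝ) * AA ^ 2 + (C (48:ℝ) * AA +
      (C (-24:ℝ) * BB + (C (-6:ℝ) * BB ^ 2 + C (-1 : ℝ) * BB ^ 3)))) := by
    simp only [map_neg, map_ofNat, map_one]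
    linear_combination ((AA * BB) ^ 2 + AA * BB * (2 * AA - BB) + (2 * AA - BB) ^ 2
      - 12 * (AA - 1) + 6 * (BB + 2)) * AB
  rw [e]
  exact ((asyA3.smul 8).add ((asyA2.smul (-24)).add ((asyA.smul 48).add ((asyB.smul (-24)).add
    ((asyB2.smul (-6)).add (asyB3.smul (-1))))))).congr
    (by norm_num) (by norm_num) (by norm_num)

/-! list statistics -/
def oneS : List ℕ → ℝ := fun _ => 1
def xS : List ℕ → ℝ := fun l => numOcc [2, 3, 4] l
def yS : List ℕ → ℝ := fun l => numOcc [4, 3, 2] l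

theorem occurs_succ (b c : List ℕ) (a i : ℕ) : Occurs b (a :: c) (i + 1) ↔ Occurs b c i := by
  unfold Occurs
  have h : ∀ j, i + 1 + j = (i + j) + 1 := by intro j; omega
  simp only [h, List.getD_cons_succ, List.length_cons]
  constructor <;> rintro ⟨h1, h2⟩ <;> exact ⟨by omega, h2⟩

theorem numOcc_cons (b c : List ℕ) (a : ℕ) :
    numOcc b (a :: c) = numOcc b c + if Occurs b (a :: c) 0 then 1 else 0 := by
  unfold numOcc
  rw [Finset.card_filter, Finset.card_filter, Finset.sum_range_succ']
  simp only [occurs_succ, List.length_cons]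

theorem numOcc_nil (x : ℕ) (b : List ℕ) : numOcc (x :: b) [] = 0 := by
  unfold numOcc
  rw [Finset.card_eq_zero, Finset.filter_eq_empty_iff]
  intro i _ h
  have := h.1
  simp at this

theorem occ3 (x y z : ℕ) (hz : 1 ≤ z) (l : List ℕ) :
    (if Occurs [x, y, z] l 0 then (1:ℝ) else 0) = UU x (UU y (UU z oneS)) l := by
  rcases l with _ | ⟨a, _ | ⟨b, _ | ⟨c, l⟩⟩⟩
  · simp [Occurs, UU]
  · simp [Occurs, UU]
  · simp [Occurs, UU]
  · have : Occurs [x, y, z] (a :: b :: c :: l) 0 ↔ x ≤ a ∧ y ≤ b ∧ z ≤ c := by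
      unfold Occurs
      constructor
      · rintro ⟨-, h⟩
        exact ⟨by simpa using h 0 (by simp), by simpa using h 1 (by simp),
          by simpa using h 2 (by simp)⟩
      · rintro ⟨h1, h2, h3⟩
        refine ⟨by simp, ?_⟩
        intro j hj
        simp only [List.length_cons, List.length_nil] at hj
        interval_cases j <;> simpa
    simp only [this, UU, oneS]
    split_ifs <;> first | rfl | (exfalso; tauto)

theorem xS_nil : xS [] = 0 := by simp [xS, numOcc_nil]
theorem yS_nil : yS [] = 0 := by simp [yS, numOcc_nil]
theorem xS_cons (a : ℕ) (c : List ℕ) : xS (a :: c) = xS c + UU 2 (UU 3 (UU 4 oneS)) (a :: c) := by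
  rw [← occ3 _ _ _ (by norm_num)]
  simp only [xS, numOcc_cons]; push_cast; rfl
theorem yS_cons (a : ℕ) (c : List ℕ) : yS (a :: c) = yS c + UU 4 (UU 3 (UU 2 oneS)) (a :: c) := by
  rw [← occ3 _ _ _ (by norm_num)]
  simp only [yS, numOcc_cons]; push_cast; rfl

/-- all parts positive -/
theorem GG_congr {f g : List ℕ → ℝ} (h : ∀ l, (∀ i ∈ l, 1 ≤ i) → f l = g l) : GG f = GG g := by
  ext n
  simp only [GG, TT, coeff_mk]
  exact Finset.sum_congr rfl fun C _ => h _ fun i hi => C.blocks_pos hi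

theorem one_rec : GG oneS = GG (nilInd + UU 1 oneS) := by
  apply GG_congr
  rintro (_ | ⟨a, l⟩) h
  · simp [oneS, nilInd, UU]
  · have : 1 ≤ a := h a (by simp)
    simp [oneS, nilInd, UU, this]

theorem x_rec : GG xS = GG (UU 1 xS + UU 2 (UU 3 (UU 4 oneS))) := by
  apply GG_congr
  rintro (_ | ⟨a, l⟩) h
  · simp [xS_nil, UU]
  · have : 1 ≤ a := h a (by simp)
    rw [xS_cons, Pi.add_apply]
    simp [UU, this]

theorem y_rec : GG yS = GG (UU 1 yS + UU 4 (UU 3 (UU 2 oneS))) := by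
  apply GG_congr
  rintro (_ | ⟨a, l⟩) h
  · simp [yS_nil, UU]
  · have : 1 ≤ a := h a (by simp)
    rw [yS_cons, Pi.add_apply]
    simp [UU, this]

/-- `p * X(tail)` -/
theorem p_x (a : ℕ) (c : List ℕ) : UU 2 (UU 3 (UU 4 oneS)) (a :: c) * xS c =
    (UU 2 (UU 3 (UU 4 xS)) + UU 2 (UU 3 (UU 4 (UU 3 (UU 4 oneS))))
      + UU 2 (UU 3 (UU 4 (UU 4 oneS)))) (a :: c) := by
  rcases c with _ | ⟨b, _ | ⟨d, e⟩⟩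
  · simp [UU]
  · simp [UU]
  · rw [xS_cons, xS_cons]
    rcases e with _ | ⟨e0, _ | ⟨e1, e⟩⟩ <;> simp only [UU, oneS, Pi.add_apply, xS_nil] <;>
      split_ifs <;> first | (exfalso; omega) | (norm_num; try ring)

theorem q_y (a : ℕ) (c : List ℕ) : UU 4 (UU 3 (UU 2 oneS)) (a :: c) * yS c =
    (UU 4 (UU 3 (UU 2 yS)) + UU 4 (UU 3 (UU 4 (UU 3 (UU 2 oneS))))
      + UU 4 (UU 4 (UU 3 (UU 2 oneS)))) (a :: c) := by
  rcases c with _ | ⟨b, _ | ⟨d, e⟩⟩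
  · simp [UU]
  · simp [UU]
  · rw [yS_cons, yS_cons]
    rcases e with _ | ⟨e0, _ | ⟨e1, e⟩⟩ <;> simp only [UU, oneS, Pi.add_apply, yS_nil] <;>
      split_ifs <;> first | (exfalso; omega) | (norm_num; try ring)

theorem p_y (a : ℕ) (c : List ℕ) : UU 2 (UU 3 (UU 4 oneS)) (a :: c) * yS c =
    (UU 2 (UU 3 (UU 4 yS)) + UU 2 (UU 3 (UU 4 (UU 3 (UU 2 oneS))))
      + UU 2 (UU 4 (UU 4 (UU 2 oneS)))) (a :: c) := by
  rcases c with _ | ⟨b, _ | ⟨d, e⟩⟩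
  · simp [UU]
  · simp [UU]
  · rw [yS_cons, yS_cons]
    rcases e with _ | ⟨e0, _ | ⟨e1, e⟩⟩ <;> simp only [UU, oneS, Pi.add_apply, yS_nil] <;>
      split_ifs <;> first | (exfalso; omega) | (norm_num; try ring)

theorem q_x (a : ℕ) (c : List ℕ) : UU 4 (UU 3 (UU 2 oneS)) (a :: c) * xS c =
    (UU 4 (UU 3 (UU 2 xS)) + UU 4 (UU 3 (UU 2 (UU 3 (UU 4 oneS))))
      + UU 4 (UU 3 (UU 3 (UU 4 oneS)))) (a :: c) := by
  rcases c with _ | ⟨b, _ | ⟨d, e⟩⟩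
  · simp [UU]
  · simp [UU]
  · rw [xS_cons, xS_cons]
    rcases e with _ | ⟨e0, _ | ⟨e1, e⟩⟩ <;> simp only [UU, oneS, Pi.add_apply, xS_nil] <;>
      split_ifs <;> first | (exfalso; omega) | (norm_num; try ring)

theorem p_q (l : List ℕ) : UU 2 (UU 3 (UU 4 oneS)) l * UU 4 (UU 3 (UU 2 oneS)) l =
    UU 4 (UU 3 (UU 4 oneS)) l := by
  rcases l with _ | ⟨a, _ | ⟨b, _ | ⟨d, e⟩⟩⟩ <;> simp only [UU, oneS] <;>
      (try split_ifs) <;> first | (exfalso; omega) | norm_num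

theorem p_p (x y z : ℕ) (l : List ℕ) :
    UU x (UU y (UU z oneS)) l ^ 2 = UU x (UU y (UU z oneS)) l := by
  rcases l with _ | ⟨a, _ | ⟨b, _ | ⟨d, e⟩⟩⟩ <;> simp only [UU, oneS] <;>
      (try split_ifs) <;> norm_num

theorem xx_rec : GG (fun l => xS l ^ 2) = GG (UU 1 (fun l => xS l ^ 2)
    + (UU 2 (UU 3 (UU 4 xS)) + UU 2 (UU 3 (UU 4 (UU 3 (UU 4 oneS))))
      + UU 2 (UU 3 (UU 4 (UU 4 oneS))))
    + (UU 2 (UU 3 (UU 4 xS)) + UU 2 (UU 3 (UU 4 (UU 3 (UU 4 oneS))))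
      + UU 2 (UU 3 (UU 4 (UU 4 oneS)))) + UU 2 (UU 3 (UU 4 oneS))) := by
  apply GG_congr
  rintro (_ | ⟨a, l⟩) h
  · simp [xS_nil, UU]
  · have h1 : 1 ≤ a := h a (by simp)
    have h2 : UU 1 (fun l => xS l ^ 2) (a :: l) = xS l ^ 2 := by simp [UU, h1]
    rw [Pi.add_apply, Pi.add_apply, Pi.add_apply, ← p_x, xS_cons, h2]
    linear_combination p_p 2 3 4 (a :: l)

theorem yy_rec : GG (fun l => yS l ^ 2) = GG (UU 1 (fun l => yS l ^ 2)
    + (UU 4 (UU 3 (UU 2 yS)) + UU 4 (UU 3 (UU 4 (UU 3 (UU 2 oneS))))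
      + UU 4 (UU 4 (UU 3 (UU 2 oneS))))
    + (UU 4 (UU 3 (UU 2 yS)) + UU 4 (UU 3 (UU 4 (UU 3 (UU 2 oneS))))
      + UU 4 (UU 4 (UU 3 (UU 2 oneS)))) + UU 4 (UU 3 (UU 2 oneS))) := by
  apply GG_congr
  rintro (_ | ⟨a, l⟩) h
  · simp [yS_nil, UU]
  · have h1 : 1 ≤ a := h a (by simp)
    have h2 : UU 1 (fun l => yS l ^ 2) (a :: l) = yS l ^ 2 := by simp [UU, h1]
    rw [Pi.add_apply, Pi.add_apply, Pi.add_apply, ← q_y, yS_cons, h2]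
    linear_combination p_p 4 3 2 (a :: l)

theorem xy_rec : GG (fun l => xS l * yS l) = GG (UU 1 (fun l => xS l * yS l)
    + (UU 2 (UU 3 (UU 4 yS)) + UU 2 (UU 3 (UU 4 (UU 3 (UU 2 oneS))))
      + UU 2 (UU 4 (UU 4 (UU 2 oneS))))
    + (UU 4 (UU 3 (UU 2 xS)) + UU 4 (UU 3 (UU 2 (UU 3 (UU 4 oneS))))
      + UU 4 (UU 3 (UU 3 (UU 4 oneS)))) + UU 4 (UU 3 (UU 4 oneS))) := by
  apply GG_congr
  rintro (_ | ⟨a, l⟩) h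
  · simp [xS_nil, UU]
  · have h1 : 1 ≤ a := h a (by simp)
    have h2 : UU 1 (fun l => xS l * yS l) (a :: l) = xS l * yS l := by simp [UU, h1]
    rw [Pi.add_apply, Pi.add_apply, Pi.add_apply, ← p_y, ← q_x, xS_cons, yS_cons, h2]
    linear_combination p_q (a :: l)

/-- solving `G = z/(1-z) G + R` -/
theorem solve {G R : PowerSeries ℝ} (h : G = SS 1 * G + R) : G = AA * (1 - X) * R := by
  rw [SS_eq] at h
  linear_combination (AA * (1 - X)) * h - G * AA_eq + (AA * X * G) * BB_eq

theorem G_one : GG oneS = AA * (1 - X) := by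
  have h := one_rec
  rw [GG_add, GG_nil, GG_U _ le_rfl, add_comm] at h
  simpa using solve h

theorem mulB (F : PowerSeries ℝ) : BB * ((1 - X) * F) = F := by
  linear_combination F * BB_eq

theorem G_x : GG xS = X ^ 9 * (AA ^ 2 * BB) := by
  have h := x_rec
  rw [GG_add, GG_U _ le_rfl] at h
  rw [solve h]
  simp only [GG_U _ (show 1 ≤ 2 by norm_num), GG_U _ (show 1 ≤ 3 by norm_num),
    GG_U _ (show 1 ≤ 4 by norm_num), G_one, SS_eq]
  have e : BB ^ 3 * (1 - X) ^ 2 = BB := by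
    linear_combination (BB * (BB * (1 - X) + 1)) * BB_eq
  linear_combination (X ^ 9 * AA ^ 2) * e

theorem G_y : GG yS = X ^ 9 * (AA ^ 2 * BB) := by
  have h := y_rec
  rw [GG_add, GG_U _ le_rfl] at h
  rw [solve h]
  simp only [GG_U _ (show 1 ≤ 2 by norm_num), GG_U _ (show 1 ≤ 3 by norm_num),
    GG_U _ (show 1 ≤ 4 by norm_num), G_one, SS_eq]
  have e : BB ^ 3 * (1 - X) ^ 2 = BB := by
    linear_combination (BB * (BB * (1 - X) + 1)) * BB_eq
  linear_combination (X ^ 9 * AA ^ 2) * e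

theorem eB (j : ℕ) : BB ^ (j + 2) * (1 - X) ^ 2 = BB ^ j := by
  linear_combination (BB ^ j * (BB * (1 - X) + 1)) * BB_eq

theorem G_xx : GG (fun l => xS l ^ 2) = C (2:ℝ) * (X ^ 18 * (AA ^ 3 * BB ^ 3))
    + (C (2:ℝ) * (X ^ 16 * (AA ^ 2 * BB ^ 3)) + (C (2:ℝ) * (X ^ 13 * (AA ^ 2 * BB ^ 2))
    + X ^ 9 * (AA ^ 2 * BB))) := by
  have h := xx_rec
  rw [add_assoc (UU 1 _), add_assoc (UU 1 _), GG_add, GG_U _ le_rfl] at h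
  rw [solve h]
  simp only [GG_U _ (show 1 ≤ 2 by norm_num), GG_U _ (show 1 ≤ 3 by norm_num),
    GG_U _ (show 1 ≤ 4 by norm_num), G_one, G_x, SS_eq, GG_add, map_ofNat]
  linear_combination (2 * X ^ 18 * AA ^ 3 * BB ^ 3) * BB_eq + (X ^ 9 * AA ^ 2) * eB 1
    + (2 * X ^ 16 * AA ^ 2) * eB 3 + (2 * X ^ 13 * AA ^ 2) * eB 2

theorem G_yy : GG (fun l => yS l ^ 2) = C (2:ℝ) * (X ^ 18 * (AA ^ 3 * BB ^ 3))
    + (C (2:ℝ) * (X ^ 16 * (AA ^ 2 * BB ^ 3)) + (C (2:ℝ) * (X ^ 13 * (AA ^ 2 * BB ^ 2))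
    + X ^ 9 * (AA ^ 2 * BB))) := by
  have h := yy_rec
  rw [add_assoc (UU 1 _), add_assoc (UU 1 _), GG_add, GG_U _ le_rfl] at h
  rw [solve h]
  simp only [GG_U _ (show 1 ≤ 2 by norm_num), GG_U _ (show 1 ≤ 3 by norm_num),
    GG_U _ (show 1 ≤ 4 by norm_num), G_one, G_y, SS_eq, GG_add, map_ofNat]
  linear_combination (2 * X ^ 18 * AA ^ 3 * BB ^ 3) * BB_eq + (X ^ 9 * AA ^ 2) * eB 1
    + (2 * X ^ 16 * AA ^ 2) * eB 3 + (2 * X ^ 13 * AA ^ 2) * eB 2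

theorem G_xy : GG (fun l => xS l * yS l) = C (2:ℝ) * (X ^ 18 * (AA ^ 3 * BB ^ 3))
    + (X ^ 14 * (AA ^ 2 * BB ^ 3) + (X ^ 12 * (AA ^ 2 * BB ^ 2) + (X ^ 16 * (AA ^ 2 * BB ^ 3)
    + (X ^ 14 * (AA ^ 2 * BB ^ 2) + X ^ 11 * (AA ^ 2 * BB))))) := by
  have h := xy_rec
  rw [add_assoc (UU 1 _), add_assoc (UU 1 _), GG_add, GG_U _ le_rfl] at h
  rw [solve h]
  simp only [GG_U _ (show 1 ≤ 2 by norm_num), GG_U _ (show 1 ≤ 3 by norm_num),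
    GG_U _ (show 1 ≤ 4 by norm_num), G_one, G_x, G_y, SS_eq, GG_add, map_ofNat]
  linear_combination (2 * X ^ 18 * AA ^ 3 * BB ^ 3) * BB_eq + (X ^ 11 * AA ^ 2) * eB 1
    + ((X ^ 16 + X ^ 14) * AA ^ 2) * eB 3 + ((X ^ 14 + X ^ 12) * AA ^ 2) * eB 2

theorem asy_x : Asy (GG xS) 0 (2 / 2 ^ 9) (-18 / 2 ^ 9) := by
  rw [G_x]
  exact (asyA2B.shift 9).congr (by norm_num) (by norm_num) (by norm_num)

theorem asy_y : Asy (GG yS) 0 (2 / 2 ^ 9) (-18 / 2 ^ 9) := by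
  rw [G_y, ← G_x]; exact asy_x

theorem compExp_eq (f : List ℕ → ℝ) (n : ℕ) (hn : 1 ≤ n) :
    compExp n (fun C => f C.blocks) = 2 * (coeff n (GG f) / 2 ^ n) := by
  obtain ⟨m, rfl⟩ : ∃ m, n = m + 1 := ⟨n - 1, by omega⟩
  simp only [compExp, GG, TT, coeff_mk, Nat.add_sub_cancel, pow_succ]
  field_simp

theorem cov_lim {F G H : PowerSeries ℝ} {b c s u v : ℝ} (hF : Asy F 0 b c) (hG : Asy G 0 b c)
    (hH : Asy H s u v) (hs : s = 2 * b ^ 2) :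
    Tendsto (fun n : ℕ => (2 * (coeff n H / 2 ^ n)
      - 2 * (coeff n F / 2 ^ n) * (2 * (coeff n G / 2 ^ n))) / (n : ℝ)) atTop
      (𝓝 (2 * u - 8 * b * c)) := by
  have hi : Tendsto (fun n : ℕ => 1 / (n : ℝ)) atTop (𝓝 0) := tendsto_one_div_atTop_nhds_zero_nat
  unfold Asy at *
  have key := (((((hH.mul hi).mul hi).const_mul 2).add (tendsto_const_nhds (x := 2 * u - 8 * b * c))).add
    (hi.const_mul (2 * v - 4 * c ^ 2))).sub
    ((((hF.add hG).mul ((hi.const_mul c).const_add b)).mul hi).const_mul 4)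
  have key2 := key.sub (((((hF.mul hG).mul hi).mul hi).mul hi).const_mul 4)
  simp only [mul_zero, zero_mul, add_zero, sub_zero, zero_add] at key2
  refine key2.congr' ?_
  filter_upwards [eventually_gt_atTop 0] with n hn
  have : (n : ℝ) ≠ 0 := by positivity
  subst hs
  generalize coeff n H / 2 ^ n = h
  generalize coeff n F / 2 ^ n = f
  generalize coeff n G / 2 ^ n = g
  field_simp
  ring

theorem cov_xy : ∃ u v, Asy (GG fun l => xS l * yS l) (2 * (2 / 2 ^ 9) ^ 2) u v ∧
    2 * u - 8 * (2 / 2 ^ 9) * (-18 / 2 ^ 9) = 71 / 2 ^ 14 := by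
  have h := (((asyA3B3.shift 18).smul 2).add ((asyA2B3.shift 14).add ((asyA2B2.shift 12).add
      ((asyA2B3.shift 16).add ((asyA2B2.shift 14).add (asyA2B.shift 11))))))
  rw [← G_xy] at h
  exact ⟨_, _, h.congr (by norm_num) rfl rfl, by norm_num⟩

theorem cov_xx : ∃ u v, Asy (GG fun l => xS l ^ 2) (2 * (2 / 2 ^ 9) ^ 2) u v ∧
    2 * u - 8 * (2 / 2 ^ 9) * (-18 / 2 ^ 9) = 147 / 2 ^ 14 := by
  have h := (((asyA3B3.shift 18).smul 2).add (((asyA2B3.shift 16).smul 2).add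
      (((asyA2B2.shift 13).smul 2).add (asyA2B.shift 9))))
  rw [← G_xx] at h
  exact ⟨_, _, h.congr (by norm_num) rfl rfl, by norm_num⟩

theorem lim_cov : Tendsto (fun n : ℕ => compCov n (occX n) (occY n) / (n : ℝ)) atTop
    (𝓝 (71 / 2 ^ 14)) := by
  obtain ⟨u, v, h, e⟩ := cov_xy
  rw [← e]
  refine (cov_lim asy_x asy_y h rfl).congr' ?_
  filter_upwards [eventually_ge_atTop 1] with n hn
  rw [← compExp_eq _ n hn, ← compExp_eq _ n hn, ← compExp_eq _ n hn]
  rfl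

theorem lim_varx : Tendsto (fun n : ℕ => compVar n (occX n) / (n : ℝ)) atTop
    (𝓝 (147 / 2 ^ 14)) := by
  obtain ⟨u, v, h, e⟩ := cov_xx
  rw [← e]
  refine (cov_lim asy_x asy_x h rfl).congr' ?_
  filter_upwards [eventually_ge_atTop 1] with n hn
  rw [← compExp_eq _ n hn, ← compExp_eq _ n hn, ← sq]
  rfl

theorem lim_vary : Tendsto (fun n : ℕ => compVar n (occY n) / (n : ℝ)) atTop
    (𝓝 (147 / 2 ^ 14)) := by
  obtain ⟨u, v, h, e⟩ := cov_xx
  rw [← e]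
  rw [G_xx, ← G_yy] at h
  refine (cov_lim asy_y asy_y h rfl).congr' ?_
  filter_upwards [eventually_ge_atTop 1] with n hn
  rw [← compExp_eq _ n hn, ← compExp_eq _ n hn, ← sq]
  rfl

/-- The asymptotic correlation between the number of occurrences of `(2,3,4)` and the
number of occurrences of `(4,3,2)` in a uniformly random composition of `n` is
`71/147`. -/
theorem correlation_tendsto :
    Filter.Tendsto rho Filter.atTop (nhds (71 / 147 : ℝ)) := by
  have h := lim_cov.div (lim_varx.sqrt.mul lim_vary.sqrt) (by positivity)
  rw [Real.mul_self_sqrt (by positivity)] at h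
  have e : (71 / 2 ^ 14 / (147 / 2 ^ 14) : ℝ) = 71 / 147 := by norm_num
  rw [e] at h
  refine h.congr' ?_
  filter_upwards [eventually_gt_atTop 0] with n hn
  have hn' : (0:ℝ) < n := by positivity
  have hq : Real.sqrt (n : ℝ) * Real.sqrt n = n := Real.mul_self_sqrt hn'.le
  simp only [Pi.div_apply]
  rw [Real.sqrt_div' _ hn'.le, Real.sqrt_div' _ hn'.le, div_mul_div_comm, hq,
    div_div_div_cancel_right₀ hn'.ne']
  rfl
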